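/- arXiv:2306.13896 — 2 statements merged into one kernel-verified Lean document; each statement's English description precedes it below -/
import Mathlib

section
/- Let a be an even positive integer and m an odd integer with 0 ≤ m ≤ a−1. If z ∈ ℂ satisfies e^{2πim/a}·conj(z) = z and z^a is a nonnegative real number, then z = 0. Consequently, for tuples a = (a_0,…,a_n) and m = (m_0,…,m_n) with 0 ≤ m_j ≤ a_j−1, if a_j is even and m_j is odd for some index j, then every z ∈ L̃_m = {z ∈ ℂ^{n+1} : z_0^{a_0}+⋯+z_n^{a_n} = 1, e^{2πi m_k/a_k}·conj(z_k) = z_k for all k, and z_k^{a_k} ≥ 0 for all k} satisfies z_j = 0. -/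
noncomputable section

/-- The reflection `R_m^a : ℂ → ℂ`, `z ↦ e^{2πim/a} ⬝ conj z`. -/
def refl1 (a m : ℕ) (z : ℂ) : ℂ :=
  Complex.exp (2 * (Real.pi : ℂ) * Complex.I * (m : ℂ) / (a : ℂ)) * (starRingEnd ℂ) z

/-- The subset `L̃_𝐦` of the Milnor fiber: points fixed by the reflections with all
`z_j^{a_j}` nonnegative real. -/
def LTilde (n : ℕ) (a m : Fin (n + 1) → ℕ) : Set (Fin (n + 1) → ℂ) :=
  {z | ∑ j, z j ^ a j = 1 ∧ (∀ j, refl1 (a j) (m j) (z j) = z j) ∧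
    ∀ j, ∃ r : ℝ, 0 ≤ r ∧ z j ^ a j = (r : ℂ)}

/-- A fixed point of `R_m^{2k}` with `m` odd has `z ^ (2k) = -|z| ^ (2k)`. -/
theorem pow_two_mul_of_refl1_eq {k m : ℕ} (hk : k ≠ 0) (hm : Odd m) {z : ℂ}
    (hz : refl1 (2 * k) m z = z) : z ^ (2 * k) = ((-Complex.normSq z ^ k : ℝ) : ℂ) := by
  unfold refl1 at hz
  set E := Complex.exp (2 * (Real.pi : ℂ) * Complex.I * (m : ℂ) / ((2 * k : ℕ) : ℂ)) with hE
  have hEk : E ^ k = -1 := by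
    have hk' : (k : ℂ) ≠ 0 := Nat.cast_ne_zero.mpr hk
    have harg : (k : ℂ) * (2 * (Real.pi : ℂ) * Complex.I * (m : ℂ) / ((2 * k : ℕ) : ℂ)) =
        m * (Real.pi * Complex.I) := by
      push_cast
      field_simp
    rw [hE, ← Complex.exp_nat_mul, harg, Complex.exp_nat_mul, Complex.exp_pi_mul_I,
      hm.neg_one_pow]
  have hsq : z ^ 2 = E * (Complex.normSq z : ℂ) := by
    rw [← Complex.mul_conj]
    linear_combination -z * hz
  rw [pow_mul, hsq, mul_pow, hEk]
  push_cast
  ring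

theorem eq_zero_of_refl1_eq {a m : ℕ} (ha : 0 < a) (hae : Even a) (hm : Odd m) {z : ℂ}
    (hz : refl1 a m z = z) (hr : ∃ r : ℝ, 0 ≤ r ∧ z ^ a = (r : ℂ)) : z = 0 := by
  obtain ⟨k, rfl⟩ := hae.two_dvd
  obtain ⟨r, hr0, hr⟩ := hr
  have hk : k ≠ 0 := by lia
  rw [pow_two_mul_of_refl1_eq hk hm hz, Complex.ofReal_inj] at hr
  have h0 : 0 ≤ Complex.normSq z ^ k := pow_nonneg (Complex.normSq_nonneg z) k
  have hpow : Complex.normSq z ^ k = 0 := by linarith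
  exact Complex.normSq_eq_zero.mp (eq_zero_of_pow_eq_zero hpow)

/-- **Lemma**: if `a` is even and `m` is odd, a fixed point `z` of `R_m^a` with `z^a ≥ 0`
must vanish; consequently, a point of `L̃_𝐦` has vanishing `j`-th coordinate whenever
`a_j` is even and `m_j` is odd. -/
theorem coordinate_vanishes_of_even_odd :
    (∀ (a m : ℕ), 0 < a → m < a → Even a → Odd m →
      ∀ z : ℂ, refl1 a m z = z → (∃ r : ℝ, 0 ≤ r ∧ z ^ a = (r : ℂ)) → z = 0) ∧
    (∀ (n : ℕ) (a m : Fin (n + 1) → ℕ), (∀ k, 0 < a k) → (∀ k, m k < a k) →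
      ∀ j : Fin (n + 1), Even (a j) → Odd (m j) →
      ∀ z : Fin (n + 1) → ℂ, z ∈ LTilde n a m → z j = 0) := by
  exact ⟨fun _ _ ha _ hae hm _ hz hr => eq_zero_of_refl1_eq ha hae hm hz hr,
    fun _ _ _ ha _ j hae hm _ hz =>
      eq_zero_of_refl1_eq (ha j) hae hm (hz.2.1 j) (hz.2.2 j)⟩
end
end

section
/- Let n ≥ 0, let a = (a_0,…,a_n) be positive integers and m = (m_0,…,m_n) integers with 0 ≤ m_j ≤ a_j−1, and set L̃_m = {z ∈ ℂ^{n+1} : z_0^{a_0}+⋯+z_n^{a_n} = 1, e^{2πi m_j/a_j}·conj(z_j) = z_j for all j, and z_j^{a_j} ≥ 0 for all j}. Let J = {j : a_j is odd, or m_j is even} (equivalently, the set of indices j for which L_{m_j} = {z ∈ ℂ : z^{a_j} = 1, e^{2πi m_j/a_j}·conj(z) = z} is nonempty). If J is nonempty, then L̃_m (with its subspace topology) is homeomorphic to the join of the spaces L_{m_j} over j ∈ J. -/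
noncomputable section

open scoped Classical

/-- The zero-dimensional real locus `L_m ⊆ V(a) ⊆ ℂ`. -/
def L1 (a m : ℕ) : Set ℂ := {z | z ^ a = 1 ∧ refl1 a m z = z}

/-- The carrier `{(x, t) ∈ Π X_i × [0,1]^ι : ∑ t_i = 1}` of the join. -/
def JoinCarrier {ι : Type} [Fintype ι] (X : ι → Type) [∀ i, TopologicalSpace (X i)] : Type :=
  {p : (∀ i, X i) × (ι → ℝ) // (∀ i, p.2 i ∈ Set.Icc (0 : ℝ) 1) ∧ ∑ i, p.2 i = 1}

instance {ι : Type} [Fintype ι] (X : ι → Type) [∀ i, TopologicalSpace (X i)] :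
    TopologicalSpace (JoinCarrier X) := by unfold JoinCarrier; infer_instance

/-- `(x,t) ∼ (x',t')` iff `t = t'` and `x_i = x'_i` whenever `t_i > 0`. -/
def joinRel {ι : Type} [Fintype ι] (X : ι → Type) [∀ i, TopologicalSpace (X i)]
    (p q : JoinCarrier X) : Prop :=
  p.1.2 = q.1.2 ∧ ∀ i, 0 < p.1.2 i → p.1.1 i = q.1.1 i

/-- The join of the family of spaces `X`, with the quotient topology. -/
def SpaceJoin {ι : Type} [Fintype ι] (X : ι → Type) [∀ i, TopologicalSpace (X i)] : Type :=
  Quot (joinRel X)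

instance {ι : Type} [Fintype ι] (X : ι → Type) [∀ i, TopologicalSpace (X i)] :
    TopologicalSpace (SpaceJoin X) := by unfold SpaceJoin; infer_instance

lemma refl1_mul_real (a m : ℕ) (z : ℂ) (c : ℝ) :
    refl1 a m (c * z) = c * refl1 a m z := by
  simp only [refl1, map_mul, Complex.conj_ofReal]
  ring

/-- The real locus is nonempty as soon as `a` is odd or `m` is even. -/
lemma L1_nonempty {a m : ℕ} (ha : 0 < a) (h : Odd a ∨ Even m) : (L1 a m).Nonempty := by
  have ha' : (a : ℂ) ≠ 0 := by exact_mod_cast ha.ne'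
  set w : ℂ := Complex.exp (Real.pi * Complex.I * m / a) with hw
  have hpow : w ^ a = (-1) ^ m := by
    rw [hw, ← Complex.exp_nat_mul, ← Complex.exp_pi_mul_I, ← Complex.exp_nat_mul]
    congr 1
    field_simp
  have hfix : refl1 a m w = w := by
    simp only [refl1, hw, ← Complex.exp_conj, map_div₀, map_mul, Complex.conj_ofReal,
      Complex.conj_I, Complex.conj_natCast, ← Complex.exp_add]
    congr 1
    field_simp
    ring
  rcases Nat.even_or_odd m with hm | hm
  · exact ⟨w, by rw [hpow, hm.neg_one_pow], hfix⟩
  · have hao : Odd a := h.resolve_right (Nat.not_even_iff_odd.mpr hm)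
    refine ⟨-w, by rw [hao.neg_pow, hpow, hm.neg_one_pow, neg_neg], ?_⟩
    have := refl1_mul_real a m w (-1)
    simpa [hfix] using this

/-- If `a` is even and `m` is odd, a fixed point of the reflection with nonnegative `a`-th power
vanishes. -/
lemma eq_zero_of_refl1_eq_self {a m : ℕ} (ha : 0 < a) (h : ¬(Odd a ∨ Even m)) {z : ℂ}
    (hz : refl1 a m z = z) {r : ℝ} (hr : 0 ≤ r) (hzr : z ^ a = r) : z = 0 := by
  rw [not_or, Nat.not_odd_iff_even, Nat.not_even_iff_odd] at h
  obtain ⟨⟨b, rfl⟩, hm⟩ := h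
  have hb : (b : ℂ) ≠ 0 := by
    have : b ≠ 0 := by omega
    exact_mod_cast this
  have hexp : Complex.exp (2 * (Real.pi : ℂ) * Complex.I * m / ((b + b : ℕ) : ℂ)) ^ b = -1 := by
    rw [← Complex.exp_nat_mul, ← hm.neg_one_pow, ← Complex.exp_pi_mul_I, ← Complex.exp_nat_mul]
    congr 1
    push_cast
    field_simp
    ring
  have hconj : z ^ b = -(starRingEnd ℂ) (z ^ b) := by
    conv_lhs => rw [← hz]
    rw [refl1, mul_pow, hexp, map_pow]
    ring
  have hre : (z ^ b).re = 0 := by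
    have := congrArg Complex.re hconj
    rw [Complex.neg_re, Complex.conj_re] at this
    linarith
  have hsq : r = -((z ^ b).im * (z ^ b).im) := by
    have := congrArg Complex.re hzr
    rw [pow_add, Complex.mul_re, hre, Complex.ofReal_re] at this
    linarith
  have him : (z ^ b).im = 0 := by
    nlinarith [mul_self_nonneg (z ^ b).im]
  exact eq_zero_of_pow_eq_zero (Complex.ext hre him : z ^ b = 0)

lemma isCompact_L1 {a m : ℕ} (ha : 0 < a) : IsCompact (L1 a m) := by
  refine Metric.isCompact_of_isClosed_isBounded ?_ ?_
  · refine IsClosed.inter (isClosed_eq (by fun_prop) continuous_const)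
      (isClosed_eq ?_ continuous_id)
    unfold refl1
    exact continuous_const.mul Complex.continuous_conj
  · refine (Metric.isBounded_closedBall (x := (0 : ℂ)) (r := 1)).subset fun z hz => ?_
    rw [mem_closedBall_zero_iff]
    exact (Complex.norm_eq_one_of_pow_eq_one hz.1 ha.ne').le

lemma compactSpace_joinCarrier {ι : Type} [Fintype ι] (X : ι → Type)
    [∀ i, TopologicalSpace (X i)] [∀ i, CompactSpace (X i)] : CompactSpace (JoinCarrier X) := by
  suffices h : IsCompact {p : (∀ i, X i) × (ι → ℝ) |
      (∀ i, p.2 i ∈ Set.Icc (0 : ℝ) 1) ∧ ∑ i, p.2 i = 1} from isCompact_iff_compactSpace.mp h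
  refine ((isCompact_univ (X := ∀ i, X i)).prod
    (isCompact_univ_pi fun _ : ι => isCompact_Icc (a := (0 : ℝ)) (b := 1))).of_isClosed_subset
    ?_ ?_
  · have hset : {p : (∀ i, X i) × (ι → ℝ) |
        (∀ i, p.2 i ∈ Set.Icc (0 : ℝ) 1) ∧ ∑ i, p.2 i = 1} =
        (⋂ i, {p | p.2 i ∈ Set.Icc (0 : ℝ) 1}) ∩ {p | ∑ i, p.2 i = 1} := by
      ext p
      simp
    rw [hset]
    exact (isClosed_iInter fun i => isClosed_Icc.preimage (by fun_prop)).inter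
      (isClosed_eq (by fun_prop) continuous_const)
  · exact fun p hp => ⟨trivial, fun i _ => hp.1 i⟩

/-- The coordinates `t_j ^ (1 / a_j) * x_j` on `J`, extended by zero. -/
def joinCoord (n : ℕ) (a m : Fin (n + 1) → ℕ)
    (p : JoinCarrier (fun j : {j : Fin (n + 1) // Odd (a j) ∨ Even (m j)} =>
        ↥(L1 (a j.1) (m j.1)))) (j : Fin (n + 1)) : ℂ :=
  if h : Odd (a j) ∨ Even (m j) then
    ((p.1.2 ⟨j, h⟩ ^ ((a j : ℝ)⁻¹) : ℝ) : ℂ) * (p.1.1 ⟨j, h⟩ : ℂ) else 0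

lemma rpow_inv_mul_pow {a m : ℕ} (ha : 0 < a) {t : ℝ} (ht : 0 ≤ t) (x : L1 a m) :
    (((t ^ ((a : ℝ)⁻¹) : ℝ) : ℂ) * (x : ℂ)) ^ a = t := by
  rw [mul_pow, x.2.1, mul_one, ← Complex.ofReal_pow, Real.rpow_inv_natCast_pow ht ha.ne']

section

variable {n : ℕ} {a m : Fin (n + 1) → ℕ}

lemma joinCoord_pow (ha : ∀ j, 0 < a j)
    (p : JoinCarrier (fun j : {j : Fin (n + 1) // Odd (a j) ∨ Even (m j)} =>
        ↥(L1 (a j.1) (m j.1)))) (j : Fin (n + 1)) :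
    joinCoord n a m p j ^ a j =
      ((if h : Odd (a j) ∨ Even (m j) then p.1.2 ⟨j, h⟩ else 0 : ℝ) : ℂ) := by
  unfold joinCoord
  split_ifs with h
  · exact rpow_inv_mul_pow (ha j) (p.2.1 ⟨j, h⟩).1 _
  · simp [(ha j).ne']

lemma sum_dite_eq_sum_subtype {ι : Type} [Fintype ι] (P : ι → Prop) [DecidablePred P]
    [Fintype {i // P i}] (g : {i // P i} → ℝ) :
    ∑ i, (if h : P i then g ⟨i, h⟩ else 0) = ∑ i, g i := by
  rw [← Finset.sum_filter_add_sum_filter_not Finset.univ P, Finset.sum_eq_zero (s := {i | ¬P i}),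
    add_zero, Finset.sum_subtype (p := P) _ (by simp)]
  · exact Finset.sum_congr rfl fun i _ => dif_pos i.2
  · exact fun i hi => dif_neg (by simpa using hi)

lemma joinCoord_mem (ha : ∀ j, 0 < a j)
    (p : JoinCarrier (fun j : {j : Fin (n + 1) // Odd (a j) ∨ Even (m j)} =>
        ↥(L1 (a j.1) (m j.1)))) : joinCoord n a m p ∈ LTilde n a m := by
  refine ⟨?_, fun j => ?_, fun j => ⟨_, ?_, joinCoord_pow ha p j⟩⟩
  · simp_rw [joinCoord_pow ha]
    rw [← Complex.ofReal_sum, sum_dite_eq_sum_subtype (fun j => Odd (a j) ∨ Even (m j)), p.2.2,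
      Complex.ofReal_one]
  · unfold joinCoord
    split_ifs with h
    · rw [refl1_mul_real, (p.1.1 ⟨j, h⟩).2.2]
    · simp [refl1]
  · split_ifs with h
    · exact (p.2.1 ⟨j, h⟩).1
    · exact le_rfl

lemma continuous_joinCoord : Continuous (joinCoord n a m) := by
  refine continuous_pi fun j => ?_
  unfold joinCoord
  split_ifs with h
  · have hval : Continuous (fun p : JoinCarrier
        (fun j : {j : Fin (n + 1) // Odd (a j) ∨ Even (m j)} => ↥(L1 (a j.1) (m j.1))) => p.1) :=
      continuous_subtype_val
    refine (Complex.continuous_ofReal.comp ?_).mul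
      (continuous_subtype_val.comp ((continuous_apply _).comp (continuous_fst.comp hval)))
    exact (Real.continuous_rpow_const (by positivity)).comp
      ((continuous_apply _).comp (continuous_snd.comp hval))
  · exact continuous_const

lemma joinCoord_eq_iff (ha : ∀ j, 0 < a j)
    (p q : JoinCarrier (fun j : {j : Fin (n + 1) // Odd (a j) ∨ Even (m j)} =>
        ↥(L1 (a j.1) (m j.1)))) :
    joinCoord n a m p = joinCoord n a m q ↔ joinRel _ p q := by
  constructor
  · intro h
    have ht : p.1.2 = q.1.2 := by
      funext j
      have := congrArg (· ^ a j.1) (congrFun h j.1)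
      simpa only [joinCoord_pow ha, dif_pos j.2, Complex.ofReal_inj] using this
    refine ⟨ht, fun j hj => Subtype.ext ?_⟩
    have := congrFun h j.1
    simp only [joinCoord, dif_pos j.2, ← ht] at this
    refine mul_left_cancel₀ ?_ this
    exact_mod_cast (Real.rpow_pos_of_pos hj _).ne'
  · rintro ⟨ht, hx⟩
    funext j
    unfold joinCoord
    split_ifs with h
    · rw [← ht]
      rcases (p.2.1 ⟨j, h⟩).1.eq_or_lt with h0 | h0
      · have : ((a j : ℝ)⁻¹) ≠ 0 := inv_ne_zero (by exact_mod_cast (ha j).ne')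
        rw [← h0, Real.zero_rpow this, Complex.ofReal_zero, zero_mul, zero_mul]
      · rw [hx _ h0]
    · rfl

lemma exists_L1_of_refl1_eq_self {a m : ℕ} (ha : 0 < a) (h : Odd a ∨ Even m) {z : ℂ}
    (hz : refl1 a m z = z) {r : ℝ} (hr : 0 ≤ r) (hzr : z ^ a = r) :
    ∃ x : L1 a m, ((r ^ ((a : ℝ)⁻¹) : ℝ) : ℂ) * (x : ℂ) = z := by
  rcases hr.eq_or_lt with rfl | hr0
  · obtain ⟨x, hx⟩ := L1_nonempty ha h
    refine ⟨⟨x, hx⟩, ?_⟩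
    have : ((a : ℝ)⁻¹) ≠ 0 := inv_ne_zero (by exact_mod_cast ha.ne')
    rw [Real.zero_rpow this, Complex.ofReal_zero, zero_mul]
    exact (eq_zero_of_pow_eq_zero (hzr.trans Complex.ofReal_zero)).symm
  · have hc : ((r ^ ((a : ℝ)⁻¹) : ℝ) : ℂ) ≠ 0 := by
      exact_mod_cast (Real.rpow_pos_of_pos hr0 _).ne'
    refine ⟨⟨(((r ^ ((a : ℝ)⁻¹))⁻¹ : ℝ) : ℂ) * z, ?_, ?_⟩, ?_⟩
    · have hr' : (r : ℂ) ≠ 0 := by exact_mod_cast hr0.ne'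
      rw [mul_pow, hzr, ← Complex.ofReal_pow, inv_pow, Real.rpow_inv_natCast_pow hr ha.ne',
        Complex.ofReal_inv, inv_mul_cancel₀ hr']
    · rw [refl1_mul_real, hz]
    · push_cast
      exact mul_inv_cancel_left₀ hc z

lemma exists_joinCoord_eq (ha : ∀ j, 0 < a j) {z : Fin (n + 1) → ℂ} (hz : z ∈ LTilde n a m) :
    ∃ p, joinCoord n a m p = z := by
  obtain ⟨hsum, hfix, hr⟩ := hz
  choose r hr0 hzr using hr
  choose x hx using fun j : {j : Fin (n + 1) // Odd (a j) ∨ Even (m j)} =>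
    exists_L1_of_refl1_eq_self (ha j.1) j.2 (hfix j.1) (hr0 j.1) (hzr j.1)
  have hzero : ∀ j, ¬(Odd (a j) ∨ Even (m j)) → z j = 0 := fun j h =>
    eq_zero_of_refl1_eq_self (ha j) h (hfix j) (hr0 j) (hzr j)
  have hrsum : ∑ j, r j = 1 := by
    simp_rw [hzr] at hsum
    exact_mod_cast hsum
  have hsub : ∑ j : {j : Fin (n + 1) // Odd (a j) ∨ Even (m j)}, r j.1 = 1 := by
    rw [← hrsum, ← sum_dite_eq_sum_subtype (fun j => Odd (a j) ∨ Even (m j))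
      (fun j => r j.1)]
    refine Finset.sum_congr rfl fun j _ => ?_
    split_ifs with h
    · rfl
    · have := hzr j
      rw [hzero j h, zero_pow (ha j).ne'] at this
      exact_mod_cast this
  refine ⟨⟨(x, fun j => r j.1), fun j => ⟨hr0 j.1, ?_⟩, hsub⟩, ?_⟩
  · rw [← hrsum]
    exact Finset.single_le_sum (fun i _ => hr0 i) (Finset.mem_univ j.1)
  · funext j
    unfold joinCoord
    split_ifs with h
    · exact hx ⟨j, h⟩
    · exact (hzero j h).symm

end

/-- **Theorem**: if `J = {j : a_j odd or m_j even}` (the indices with `L_{m_j} ≠ ∅`) is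
nonempty, then `L̃_𝐦` is homeomorphic to the join of the spaces `L_{m_j}`, `j ∈ J`. -/
theorem ltilde_homeomorphic_join (n : ℕ) (a m : Fin (n + 1) → ℕ)
    (ha : ∀ j, 0 < a j) (hm : ∀ j, m j < a j)
    (hJ : ∃ j : Fin (n + 1), Odd (a j) ∨ Even (m j)) :
    Nonempty (↥(LTilde n a m) ≃ₜ
      SpaceJoin (fun j : {j : Fin (n + 1) // Odd (a j) ∨ Even (m j)} =>
        ↥(L1 (a j.1) (m j.1)))) := by
  let X := fun j : {j : Fin (n + 1) // Odd (a j) ∨ Even (m j)} => ↥(L1 (a j.1) (m j.1))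
  have : ∀ j, CompactSpace (X j) := fun j =>
    isCompact_iff_compactSpace.mp (isCompact_L1 (ha j.1))
  have := compactSpace_joinCarrier X
  have : CompactSpace (SpaceJoin X) := inferInstanceAs (CompactSpace (Quot (joinRel X)))
  let f : SpaceJoin X → LTilde n a m :=
    Quot.lift (fun p => ⟨joinCoord n a m p, joinCoord_mem ha p⟩)
      fun p q h => Subtype.ext ((joinCoord_eq_iff ha p q).mpr h)
  have hf : Continuous f := continuous_quot_lift _ (continuous_joinCoord.subtype_mk _)
  have hbij : Function.Bijective f := by
    constructor
    · rintro ⟨p⟩ ⟨q⟩ h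
      exact Quot.sound ((joinCoord_eq_iff ha p q).mp (congrArg Subtype.val h))
    · rintro ⟨z, hz⟩
      obtain ⟨p, hp⟩ := exists_joinCoord_eq ha hz
      exact ⟨Quot.mk _ p, Subtype.ext hp⟩
  exact ⟨(Continuous.homeoOfEquivCompactToT2 (f := Equiv.ofBijective f hbij) hf).symm⟩
end
end
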